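/- For every nonzero λ ∈ k^c, the algebra A is a free k[u_λ]-module of rank a^{c−1}, both as a left k[u_λ]-module (via left multiplication by u_λ) and as a right k[u_λ]-module (via right multiplication by u_λ). -/

import Mathlib

/-- The defining relations of the homogeneous quantum complete intersection with `c`
generators `x_i`, all exponents equal to `a`, and all commutators equal to `q`:
`x_i ^ a = 0` for all `i`, and `x_i x_j = q • (x_j x_i)` for `i < j`. -/
inductive QCIRel (k : Type) [Field k] (c a : ℕ) (q : k) :
    FreeAlgebra k (Fin c) → FreeAlgebra k (Fin c) → Prop
  | pow (i : Fin c) : QCIRel k c a q (FreeAlgebra.ι k i ^ a) 0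
  | comm (i j : Fin c) (hij : i < j) :
      QCIRel k c a q (FreeAlgebra.ι k i * FreeAlgebra.ι k j)
        (q • (FreeAlgebra.ι k j * FreeAlgebra.ι k i))

/-- The homogeneous quantum complete intersection `A = k⟨x_1,…,x_c⟩/(x_i^a, x_ix_j - q x_jx_i)`. -/
abbrev QCI (k : Type) [Field k] (c a : ℕ) (q : k) : Type := RingQuot (QCIRel k c a q)

/-- The image of the generator `x_i` in `A`. -/
noncomputable def Xgen (k : Type) [Field k] (c a : ℕ) (q : k) (i : Fin c) : QCI k c a q :=
  RingQuot.mkAlgHom k (QCIRel k c a q) (FreeAlgebra.ι k i)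

/-- The element `u_λ = λ_1 x_1 + ⋯ + λ_c x_c` of `A`. -/
noncomputable def uElt (k : Type) [Field k] (c a : ℕ) (q : k) (lam : Fin c → k) :
    QCI k c a q :=
  ∑ i, lam i • Xgen k c a q i

/-- The coefficient of `z ^ i * y ^ j` in `(y + z) ^ (i + j)` when `y * z = q • (z * y)`. -/
def qBinom {k : Type*} [Semiring k] (q : k) : ℕ → ℕ → k
  | 0, _ => 1
  | _ + 1, 0 => 1
  | i + 1, j + 1 => qBinom q i (j + 1) + q ^ (i + 1) * qBinom q (i + 1) j

lemma qBinom_zero_right {k : Type*} [Semiring k] (q : k) (i : ℕ) : qBinom q i 0 = 1 := by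
  cases i <;> simp [qBinom]

/-- The product `(1 - q) (1 - q ^ 2) ⋯ (1 - q ^ n)`. -/
def qFact {k : Type*} [CommRing k] (q : k) (n : ℕ) : k :=
  ∏ m ∈ Finset.range n, (1 - q ^ (m + 1))

lemma qFact_succ {k : Type*} [CommRing k] (q : k) (n : ℕ) :
    qFact q (n + 1) = qFact q n * (1 - q ^ (n + 1)) :=
  Finset.prod_range_succ _ _

lemma qBinom_mul_qFact_mul_qFact {k : Type*} [CommRing k] (q : k) (i j : ℕ) :
    qBinom q i j * (qFact q i * qFact q j) = qFact q (i + j) := by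
  induction i generalizing j with
  | zero => simp [qBinom, qFact]
  | succ i ihi =>
    induction j with
    | zero => simp [qBinom, qFact]
    | succ j ihj =>
      have h1 := ihi (j + 1)
      have h2 : qFact q (i + 1 + (j + 1)) = qFact q (i + (j + 1)) * (1 - q ^ (i + j + 2)) := by
        rw [show i + 1 + (j + 1) = i + (j + 1) + 1 by ring, qFact_succ]
        ring
      have h3 : qFact q (i + 1 + j) = qFact q (i + (j + 1)) := by congr 1; ring
      rw [h3] at ihj
      rw [h2, qBinom]
      rw [qFact_succ q i] at ihj ⊢
      rw [qFact_succ q j] at h1 ⊢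
      linear_combination (1 - q ^ (i + 1)) * h1 + q ^ (i + 1) * (1 - q ^ (j + 1)) * ihj

lemma qFact_ne_zero {k : Type*} [Field k] {q : k} {b : ℕ} (hq : IsPrimitiveRoot q b) {n : ℕ}
    (hn : n < b) : qFact q n ≠ 0 := by
  refine Finset.prod_ne_zero_iff.2 fun m hm => sub_ne_zero.2 (Ne.symm ?_)
  exact hq.pow_ne_one_of_pos_of_lt (by omega) (by have := Finset.mem_range.1 hm; omega)

lemma qBinom_eq_zero {k : Type*} [Field k] {q : k} {i j : ℕ}
    (hq : IsPrimitiveRoot q (i + j)) (hi : i ≠ 0) (hj : j ≠ 0) : qBinom q i j = 0 := by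
  have h := qBinom_mul_qFact_mul_qFact q i j
  have h0 : qFact q (i + j) = 0 := by
    refine Finset.prod_eq_zero (i := i + j - 1) (Finset.mem_range.2 (by omega)) ?_
    rw [show i + j - 1 + 1 = i + j by omega, hq.pow_eq_one, sub_self]
  rw [h0] at h
  simpa [qFact_ne_zero hq (show i < i + j by omega),
    qFact_ne_zero hq (show j < i + j by omega)] using h

lemma mul_pow_of_qCommute {k A : Type*} [CommSemiring k] [Semiring A] [Algebra k A] {q : k}
    {y z : A} (h : y * z = q • (z * y)) (n : ℕ) : y * z ^ n = q ^ n • (z ^ n * y) := by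
  induction n with
  | zero => simp
  | succ n ih =>
    rw [pow_succ, ← mul_assoc, ih, smul_mul_assoc, mul_assoc, h, mul_smul_comm, smul_smul,
      pow_succ, mul_assoc]

lemma pow_mul_pow_of_qCommute {k A : Type*} [CommSemiring k] [Semiring A] [Algebra k A] {q : k}
    {y z : A} (h : y * z = q • (z * y)) (m n : ℕ) :
    y ^ m * z ^ n = q ^ (m * n) • (z ^ n * y ^ m) := by
  induction m with
  | zero => simp
  | succ m ih =>
    rw [pow_succ, mul_assoc, mul_pow_of_qCommute h, mul_smul_comm, ← mul_assoc, ih,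
      smul_mul_assoc, smul_smul, ← pow_add, mul_assoc]
    congr 2
    ring

/-- The noncommutative `q`-binomial theorem. -/
lemma add_pow_of_qCommute {k A : Type*} [CommSemiring k] [Semiring A] [Algebra k A] {q : k}
    {y z : A} (h : y * z = q • (z * y)) (n : ℕ) :
    (y + z) ^ n = ∑ m ∈ Finset.HasAntidiagonal.antidiagonal n, qBinom q m.1 m.2 • (z ^ m.1 * y ^ m.2) := by
  induction n with
  | zero => simp [qBinom]
  | succ n ih =>
    let L : ℕ → ℕ → k := fun i j => match i with | 0 => 0 | i + 1 => qBinom q i j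
    let R : ℕ → ℕ → k := fun i j => match j with | 0 => 0 | j + 1 => q ^ i * qBinom q i j
    have hLR : ∀ m ∈ Finset.HasAntidiagonal.antidiagonal (n + 1),
        qBinom q m.1 m.2 • (z ^ m.1 * y ^ m.2) =
          R m.1 m.2 • (z ^ m.1 * y ^ m.2) + L m.1 m.2 • (z ^ m.1 * y ^ m.2) := by
      rintro ⟨i, j⟩ hm
      rw [← add_smul]
      congr 1
      rcases i with _ | i <;> rcases j with _ | j
      · simp at hm
      · simp [L, R, qBinom]
      · simp [L, R, qBinom_zero_right]
      · simp [L, R, qBinom, add_comm]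
    rw [Finset.sum_congr rfl hLR, Finset.sum_add_distrib, Finset.Nat.sum_antidiagonal_succ',
      Finset.Nat.sum_antidiagonal_succ, pow_succ', ih, add_mul, Finset.mul_sum, Finset.mul_sum]
    simp only [L, R, zero_smul, zero_add]
    congr 1
    · refine Finset.sum_congr rfl fun m _ => ?_
      rw [mul_smul_comm, ← mul_assoc, mul_pow_of_qCommute h, smul_mul_assoc, smul_smul, mul_assoc,
        ← pow_succ', mul_comm]
    · refine Finset.sum_congr rfl fun m _ => ?_
      rw [mul_smul_comm, ← mul_assoc, ← pow_succ']

lemma add_pow_of_isPrimitiveRoot {k A : Type*} [Field k] [Semiring A] [Algebra k A] {q : k}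
    {b : ℕ} (hb : b ≠ 0) (hq : IsPrimitiveRoot q b) {y z : A} (h : y * z = q • (z * y)) :
    (y + z) ^ b = y ^ b + z ^ b := by
  rw [add_pow_of_qCommute h, Finset.sum_eq_add (0, b) (b, 0)]
  · simp [qBinom, qBinom_zero_right]
  · simp [hb.symm]
  · rintro ⟨i, j⟩ hm ⟨h1, h2⟩
    obtain rfl : i + j = b := by simpa using hm
    rw [qBinom_eq_zero hq, zero_smul]
    · rintro rfl; simp at h1
    · rintro rfl; simp at h2
  · simp
  · simp

lemma add_pow_of_qCommute_of_char {k A : Type*} [Field k] [Semiring A] [Algebra k A]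
    {a b : ℕ} (ha : a ≠ 0)
    (hb : b = if ringChar k = 0 then a else a / Nat.gcd a (ringChar k)) {q : k}
    (hq : IsPrimitiveRoot q b) {y z : A} (h : y * z = q • (z * y)) :
    (y + z) ^ a = y ^ a + z ^ a := by
  by_cases hba : b = a
  · subst hba
    exact add_pow_of_isPrimitiveRoot ha hq h
  · have hp0 : ringChar k ≠ 0 := fun h0 => hba (by rw [hb, if_pos h0])
    rw [if_neg hp0] at hb
    have hp : (ringChar k).Prime :=
      (CharP.char_is_prime_or_zero k (ringChar k)).resolve_right hp0
    have hdvd : ringChar k ∣ a := by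
      by_contra hnd
      have : Nat.gcd a (ringChar k) = 1 := ((Nat.Prime.coprime_iff_not_dvd hp).2 hnd).symm
      simp [this] at hb
      exact hba hb
    rw [Nat.gcd_eq_right hdvd] at hb
    have hab : a = b * ringChar k := by rw [hb, Nat.div_mul_cancel hdvd]
    have hb0 : b ≠ 0 := by rintro rfl; simp at hab; exact ha hab
    have hcomm : Commute (y ^ b) (z ^ b) := by
      have := pow_mul_pow_of_qCommute h b b
      rwa [pow_mul, hq.pow_eq_one, one_pow, one_smul] at this
    have hcast : ((ringChar k : ℕ) : A) = 0 := by
      rw [← map_natCast (algebraMap k A), ringChar.Nat.cast_ringChar, map_zero]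
    rw [hab, pow_mul, add_pow_of_isPrimitiveRoot hb0 hq h, hcomm.add_pow_prime_eq hp, hcast,
      pow_mul, pow_mul]
    simp

section QCI

variable {k : Type} [Field k] {c a : ℕ} {q : k}

lemma Xgen_pow (i : Fin c) : Xgen k c a q i ^ a = 0 := by
  have h := RingQuot.mkAlgHom_rel k (QCIRel.pow (k := k) (a := a) (q := q) i)
  rwa [map_pow, map_zero] at h

lemma Xgen_mul_Xgen {i j : Fin c} (hij : i < j) :
    Xgen k c a q i * Xgen k c a q j = q • (Xgen k c a q j * Xgen k c a q i) := by
  have h := RingQuot.mkAlgHom_rel k (QCIRel.comm (k := k) (a := a) (q := q) i j hij)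
  rwa [map_mul, map_smul, map_mul] at h

lemma exists_Xgen_mul_Xgen (hq : q ≠ 0) (i j : Fin c) : ∃ s : k, s ≠ 0 ∧
    Xgen k c a q i * Xgen k c a q j = s • (Xgen k c a q j * Xgen k c a q i) := by
  rcases lt_trichotomy i j with h | rfl | h
  · exact ⟨q, hq, Xgen_mul_Xgen h⟩
  · exact ⟨1, one_ne_zero, (one_smul _ _).symm⟩
  · exact ⟨q⁻¹, inv_ne_zero hq, by rw [Xgen_mul_Xgen h, smul_smul, inv_mul_cancel₀ hq, one_smul]⟩

lemma exists_Xgen_mul_Xgen_pow (hq : q ≠ 0) (i j : Fin c) (n : ℕ) : ∃ s : k, s ≠ 0 ∧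
    Xgen k c a q i * Xgen k c a q j ^ n = s • (Xgen k c a q j ^ n * Xgen k c a q i) := by
  obtain ⟨s, hs, h⟩ := exists_Xgen_mul_Xgen (a := a) hq i j
  exact ⟨s ^ n, pow_ne_zero n hs, mul_pow_of_qCommute h n⟩

lemma eq_top_of_mul_Xgen_mem (M : Submodule k (QCI k c a q)) (h1 : 1 ∈ M)
    (hM : ∀ m ∈ M, ∀ j, m * Xgen k c a q j ∈ M) : M = ⊤ := by
  have key : ∀ (p : FreeAlgebra k (Fin c)), ∀ m ∈ M,
      m * RingQuot.mkAlgHom k (QCIRel k c a q) p ∈ M := by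
    intro p
    induction p using FreeAlgebra.induction with
    | grade0 r =>
      intro m hm
      rw [AlgHom.commutes, ← Algebra.commutes, ← Algebra.smul_def]
      exact M.smul_mem r hm
    | grade1 x => exact fun m hm => hM m hm x
    | mul x y hx hy =>
      intro m hm
      rw [map_mul, ← mul_assoc]
      exact hy _ (hx m hm)
    | add x y hx hy =>
      intro m hm
      rw [map_add, mul_add]
      exact M.add_mem (hx m hm) (hy m hm)
  refine eq_top_iff.2 fun x _ => ?_
  obtain ⟨p, rfl⟩ := RingQuot.mkAlgHom_surjective k (QCIRel k c a q) x
  simpa using key p 1 h1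

lemma eq_top_of_Xgen_mul_mem (M : Submodule k (QCI k c a q)) (h1 : 1 ∈ M)
    (hM : ∀ m ∈ M, ∀ j, Xgen k c a q j * m ∈ M) : M = ⊤ := by
  have key : ∀ (p : FreeAlgebra k (Fin c)), ∀ m ∈ M,
      RingQuot.mkAlgHom k (QCIRel k c a q) p * m ∈ M := by
    intro p
    induction p using FreeAlgebra.induction with
    | grade0 r =>
      intro m hm
      rw [AlgHom.commutes, ← Algebra.smul_def]
      exact M.smul_mem r hm
    | grade1 x => exact fun m hm => hM m hm x
    | mul x y hx hy =>
      intro m hm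
      rw [map_mul, mul_assoc]
      exact hx _ (hy m hm)
    | add x y hx hy =>
      intro m hm
      rw [map_add, add_mul]
      exact M.add_mem (hx m hm) (hy m hm)
  refine eq_top_iff.2 fun x _ => ?_
  obtain ⟨p, rfl⟩ := RingQuot.mkAlgHom_surjective k (QCIRel k c a q) x
  simpa using key p 1 h1

lemma uElt_pow (ha : a ≠ 0) {b : ℕ}
    (hb : b = if ringChar k = 0 then a else a / Nat.gcd a (ringChar k))
    (hq : IsPrimitiveRoot q b) (lam : Fin c → k) : uElt k c a q lam ^ a = 0 := by
  suffices h : ∀ s : Finset (Fin c), (∑ i ∈ s, lam i • Xgen k c a q i) ^ a = 0 from h _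
  intro s
  induction s using Finset.induction_on_max with
  | empty => simp [ha]
  | insert m s hm ih =>
    have hc : (∑ i ∈ s, lam i • Xgen k c a q i) * (lam m • Xgen k c a q m) =
        q • ((lam m • Xgen k c a q m) * ∑ i ∈ s, lam i • Xgen k c a q i) := by
      rw [Finset.sum_mul, Finset.mul_sum, Finset.smul_sum]
      refine Finset.sum_congr rfl fun i hi => ?_
      simp only [smul_mul_assoc, mul_smul_comm, Xgen_mul_Xgen (hm i hi), smul_smul]
      congr 1
      ring
    rw [Finset.sum_insert fun h => lt_irrefl _ (hm m h), add_comm,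
      add_pow_of_qCommute_of_char ha hb hq hc, ih, smul_pow, Xgen_pow, smul_zero, add_zero]

/-! ### Monomials -/

/-- The monomial `∏ x_j ^ e j`, taken over the entries of the list `l` in their order. -/
noncomputable def qMon (k : Type) [Field k] (c a : ℕ) (q : k) (l : List (Fin c))
    (e : Fin c → ℕ) : QCI k c a q :=
  (l.map fun j => Xgen k c a q j ^ e j).prod

lemma qMon_cons (j : Fin c) (l : List (Fin c)) (e : Fin c → ℕ) :
    qMon k c a q (j :: l) e = Xgen k c a q j ^ e j * qMon k c a q l e := by
  simp [qMon]

lemma qMon_congr {l : List (Fin c)} {e e' : Fin c → ℕ} (h : ∀ j ∈ l, e j = e' j) :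
    qMon k c a q l e = qMon k c a q l e' := by
  unfold qMon
  rw [List.map_congr_left fun j hj => by rw [h j hj]]

lemma qMon_eq_zero {l : List (Fin c)} {e : Fin c → ℕ} {j : Fin c} (hj : j ∈ l) (h : a ≤ e j) :
    qMon k c a q l e = 0 := by
  refine List.prod_eq_zero (List.mem_map.2 ⟨j, hj, ?_⟩)
  exact pow_eq_zero_of_le h (Xgen_pow j)

lemma exists_Xgen_mul_qMon (hq : q ≠ 0) (i : Fin c) (l : List (Fin c)) (e : Fin c → ℕ) :
    ∃ s : k, s ≠ 0 ∧
      Xgen k c a q i * qMon k c a q l e = s • (qMon k c a q l e * Xgen k c a q i) := by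
  induction l with
  | nil => exact ⟨1, one_ne_zero, by simp [qMon]⟩
  | cons j l ih =>
    obtain ⟨s, hs, h⟩ := ih
    obtain ⟨t, ht, h'⟩ := exists_Xgen_mul_Xgen_pow (a := a) hq i j (e j)
    refine ⟨t * s, mul_ne_zero ht hs, ?_⟩
    rw [qMon_cons, ← mul_assoc, h', smul_mul_assoc, mul_assoc, h, mul_smul_comm, smul_smul,
      mul_assoc]

lemma exists_Xgen_mul_qMon_of_mem (hq : q ≠ 0) {j : Fin c} {l : List (Fin c)} (hl : l.Nodup)
    (hj : j ∈ l) (e : Fin c → ℕ) :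
    ∃ s : k, Xgen k c a q j * qMon k c a q l e =
      s • qMon k c a q l (Function.update e j (e j + 1)) := by
  induction l with
  | nil => simp at hj
  | cons i l ih =>
    rw [List.nodup_cons] at hl
    by_cases hji : j = i
    · subst hji
      refine ⟨1, ?_⟩
      rw [one_smul, qMon_cons, qMon_cons, ← mul_assoc, ← pow_succ', Function.update_self]
      congr 1
      refine qMon_congr fun i hi => ?_
      rw [Function.update_of_ne]
      rintro rfl
      exact hl.1 hi
    · obtain ⟨s, h⟩ := ih hl.2 ((List.mem_cons.1 hj).resolve_left hji)
      obtain ⟨t, -, h'⟩ := exists_Xgen_mul_Xgen_pow (a := a) hq j i (e i)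
      refine ⟨t * s, ?_⟩
      rw [qMon_cons, qMon_cons, ← mul_assoc, h', smul_mul_assoc, mul_assoc, h, mul_smul_comm,
        smul_smul, Function.update_of_ne (Ne.symm hji)]

lemma exists_qMon_mul_Xgen_of_mem (hq : q ≠ 0) {j : Fin c} {l : List (Fin c)} (hl : l.Nodup)
    (hj : j ∈ l) (e : Fin c → ℕ) :
    ∃ s : k, qMon k c a q l e * Xgen k c a q j =
      s • qMon k c a q l (Function.update e j (e j + 1)) := by
  obtain ⟨s, h⟩ := exists_Xgen_mul_qMon_of_mem (a := a) hq hl hj e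
  obtain ⟨t, ht, h'⟩ := exists_Xgen_mul_qMon (a := a) hq j l e
  exact ⟨t⁻¹ * s, by rw [← smul_smul, ← h, h', smul_smul, inv_mul_cancel₀ ht, one_smul]⟩

lemma Xgen_eq_smul_uElt_sub {lam : Fin c → k} {i : Fin c} (hi : lam i ≠ 0) :
    Xgen k c a q i = (lam i)⁻¹ • (uElt k c a q lam -
      ∑ j ∈ Finset.univ.erase i, lam j • Xgen k c a q j) := by
  rw [uElt, ← Finset.add_sum_erase _ _ (Finset.mem_univ i), add_sub_cancel_right, smul_smul,
    inv_mul_cancel₀ hi, one_smul]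

lemma span_adjoin_mul_qMon (hq : q ≠ 0) {lam : Fin c → k} {i : Fin c} (hi : lam i ≠ 0)
    {l : List (Fin c)} (hl : l.Nodup) (hmem : ∀ j, j ∈ l ↔ j ≠ i) :
    Submodule.span k {x : QCI k c a q | ∃ p ∈ Algebra.adjoin k {uElt k c a q lam}, ∃ e,
      x = p * qMon k c a q l e} = ⊤ := by
  refine eq_top_of_mul_Xgen_mem _ ?_ ?_
  · exact Submodule.subset_span ⟨1, one_mem _, 0, by simp [qMon]⟩
  · intro m hm j
    induction hm using Submodule.span_induction with
    | zero => simp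
    | add x y _ _ hx hy => rw [add_mul]; exact add_mem hx hy
    | smul r x _ hx => rw [smul_mul_assoc]; exact Submodule.smul_mem _ _ hx
    | mem x hx =>
      obtain ⟨p, hp, e, rfl⟩ := hx
      by_cases hj : j = i
      · subst hj
        obtain ⟨t, ht, h'⟩ := exists_Xgen_mul_qMon (a := a) hq j l e
        have h2 : qMon k c a q l e * Xgen k c a q j =
            t⁻¹ • (Xgen k c a q j * qMon k c a q l e) := by
          rw [h', smul_smul, inv_mul_cancel₀ ht, one_smul]
        rw [mul_assoc, h2, Xgen_eq_smul_uElt_sub hi, smul_mul_assoc, mul_smul_comm,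
          mul_smul_comm, sub_mul, mul_sub, Finset.sum_mul, Finset.mul_sum]
        refine Submodule.smul_mem _ _ (Submodule.smul_mem _ _ (sub_mem ?_ (sum_mem ?_)))
        · exact Submodule.subset_span ⟨_, mul_mem hp (Algebra.subset_adjoin rfl), e,
            (mul_assoc _ _ _).symm⟩
        · intro i' hi'
          obtain ⟨s, hs⟩ := exists_Xgen_mul_qMon_of_mem (a := a) hq hl
            ((hmem i').2 (Finset.ne_of_mem_erase hi')) e
          rw [smul_mul_assoc, hs, mul_smul_comm, mul_smul_comm]
          exact Submodule.smul_mem _ _ (Submodule.smul_mem _ _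
            (Submodule.subset_span ⟨p, hp, _, rfl⟩))
      · obtain ⟨s, hs⟩ := exists_qMon_mul_Xgen_of_mem (a := a) hq hl ((hmem j).2 hj) e
        rw [mul_assoc, hs, mul_smul_comm]
        exact Submodule.smul_mem _ _ (Submodule.subset_span ⟨p, hp, _, rfl⟩)

lemma span_qMon_mul_adjoin (hq : q ≠ 0) {lam : Fin c → k} {i : Fin c} (hi : lam i ≠ 0)
    {l : List (Fin c)} (hl : l.Nodup) (hmem : ∀ j, j ∈ l ↔ j ≠ i) :
    Submodule.span k {x : QCI k c a q | ∃ p ∈ Algebra.adjoin k {uElt k c a q lam}, ∃ e,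
      x = qMon k c a q l e * p} = ⊤ := by
  refine eq_top_of_Xgen_mul_mem _ ?_ ?_
  · exact Submodule.subset_span ⟨1, one_mem _, 0, by simp [qMon]⟩
  · intro m hm j
    induction hm using Submodule.span_induction with
    | zero => simp
    | add x y _ _ hx hy => rw [mul_add]; exact add_mem hx hy
    | smul r x _ hx => rw [mul_smul_comm]; exact Submodule.smul_mem _ _ hx
    | mem x hx =>
      obtain ⟨p, hp, e, rfl⟩ := hx
      by_cases hj : j = i
      · subst hj
        obtain ⟨t, ht, h'⟩ := exists_Xgen_mul_qMon (a := a) hq j l e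
        rw [← mul_assoc, h', Xgen_eq_smul_uElt_sub hi, mul_smul_comm, smul_mul_assoc,
          smul_mul_assoc, mul_sub, sub_mul, Finset.mul_sum, Finset.sum_mul]
        refine Submodule.smul_mem _ _ (Submodule.smul_mem _ _ (sub_mem ?_ (sum_mem ?_)))
        · exact Submodule.subset_span ⟨_, mul_mem (Algebra.subset_adjoin rfl) hp, e,
            mul_assoc _ _ _⟩
        · intro i' hi'
          obtain ⟨s, hs⟩ := exists_qMon_mul_Xgen_of_mem (a := a) hq hl
            ((hmem i').2 (Finset.ne_of_mem_erase hi')) e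
          rw [mul_smul_comm, hs, smul_mul_assoc, smul_mul_assoc]
          exact Submodule.smul_mem _ _ (Submodule.smul_mem _ _
            (Submodule.subset_span ⟨p, hp, _, rfl⟩))
      · obtain ⟨s, hs⟩ := exists_Xgen_mul_qMon_of_mem (a := a) hq hl ((hmem j).2 hj) e
        rw [← mul_assoc, hs, smul_mul_assoc]
        exact Submodule.smul_mem _ _ (Submodule.subset_span ⟨p, hp, _, rfl⟩)

/-! ### The dimension of the algebra -/

/-- Left multiplication by `x_i` on the algebra, in the coordinates given by the monomials
`x_c ^ m_c ⋯ x_1 ^ m_1`. -/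
def shiftOp (a : ℕ) (q : k) (i : Fin c) : Module.End k ((Fin c → ℕ) → k) where
  toFun f m := if 0 < m i ∧ m i < a then
    q ^ (∑ l ∈ Finset.Ioi i, m l) * f (Function.update m i (m i - 1)) else 0
  map_add' f g := by
    ext m
    simp only [Pi.add_apply]
    split_ifs <;> ring
  map_smul' r f := by
    ext m
    simp only [Pi.smul_apply, smul_eq_mul, RingHom.id_apply]
    split_ifs <;> ring

lemma shiftOp_apply (i : Fin c) (f : (Fin c → ℕ) → k) (m : Fin c → ℕ) :
    shiftOp a q i f m = if 0 < m i ∧ m i < a then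
      q ^ (∑ l ∈ Finset.Ioi i, m l) * f (Function.update m i (m i - 1)) else 0 := rfl

lemma shiftOp_pow (ha : a ≠ 0) (i : Fin c) : shiftOp a q i ^ a = 0 := by
  have key : ∀ n : ℕ, ∀ f : (Fin c → ℕ) → k, ∀ m : Fin c → ℕ, m i < n →
      (shiftOp a q i ^ n) f m = 0 := by
    intro n
    induction n with
    | zero => intro f m hm; omega
    | succ n ih =>
      intro f m hm
      rw [pow_succ', Module.End.mul_apply, shiftOp_apply]
      split_ifs with h
      · rw [ih, mul_zero]
        rw [Function.update_self]
        omega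
      · rfl
  ext1 f
  funext m
  by_cases hm : m i < a
  · exact key a f m hm
  · obtain ⟨n, rfl⟩ := Nat.exists_eq_succ_of_ne_zero ha
    rw [Nat.succ_eq_add_one, pow_succ', Module.End.mul_apply, shiftOp_apply,
      if_neg fun h => hm h.2]
    rfl

lemma shiftOp_mul_shiftOp {i j : Fin c} (hij : i < j) :
    shiftOp a q i * shiftOp a q j = q • (shiftOp a q j * shiftOp a q i) := by
  ext1 f
  funext m
  rw [LinearMap.smul_apply, Pi.smul_apply, Module.End.mul_apply, Module.End.mul_apply,
    shiftOp_apply, shiftOp_apply, shiftOp_apply, shiftOp_apply, Function.update_of_ne hij.ne',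
    Function.update_of_ne hij.ne, Function.update_comm hij.ne]
  have h1 : ∑ l ∈ Finset.Ioi j, Function.update m i (m i - 1) l = ∑ l ∈ Finset.Ioi j, m l := by
    refine Finset.sum_congr rfl fun l hl => Function.update_of_ne ?_ _ _
    exact (hij.trans (Finset.mem_Ioi.1 hl)).ne'
  rw [h1]
  by_cases hi : 0 < m i ∧ m i < a <;> by_cases hj : 0 < m j ∧ m j < a
  · have h2 : ∑ l ∈ Finset.Ioi i, m l =
        ∑ l ∈ Finset.Ioi i, Function.update m j (m j - 1) l + 1 := by
      rw [Finset.sum_update_of_mem (Finset.mem_Ioi.2 hij),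
        Finset.sum_eq_add_sum_sdiff_singleton_of_mem (Finset.mem_Ioi.2 hij)]
      omega
    rw [if_pos hi, if_pos hj, if_pos hj, if_pos hi, h2, smul_eq_mul]
    ring
  · simp [hj]
  · simp [hi]
  · simp [hi]

/-- The representation of the algebra in which `x_i` acts by `shiftOp a q i`. -/
noncomputable def shiftRep (c : ℕ) (ha : a ≠ 0) (q : k) :
    QCI k c a q →ₐ[k] Module.End k ((Fin c → ℕ) → k) :=
  RingQuot.liftAlgHom k ⟨FreeAlgebra.lift k (shiftOp a q), by
    rintro _ _ (i | ⟨i, j, hij⟩)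
    · rw [map_pow, FreeAlgebra.lift_ι_apply, shiftOp_pow ha, map_zero]
    · rw [map_mul, map_smul, map_mul, FreeAlgebra.lift_ι_apply, FreeAlgebra.lift_ι_apply,
        shiftOp_mul_shiftOp hij]⟩

lemma shiftRep_Xgen (ha : a ≠ 0) (i : Fin c) :
    shiftRep c ha q (Xgen k c a q i) = shiftOp a q i := by
  rw [shiftRep, Xgen, RingQuot.liftAlgHom_mkAlgHom_apply, FreeAlgebra.lift_ι_apply]

lemma exists_shiftRep_eq_single (ha : a ≠ 0) (hq : q ≠ 0) (m : Fin c → ℕ) (hm : ∀ i, m i < a) :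
    ∃ x, shiftRep c ha q x (Pi.single 0 1) = Pi.single m 1 := by
  induction hn : ∑ i, m i generalizing m with
  | zero =>
    have : m = 0 := by
      funext i
      exact (Finset.sum_eq_zero_iff.1 hn) i (Finset.mem_univ i)
    exact ⟨1, by rw [map_one, this, Module.End.one_apply]⟩
  | succ n ih =>
    obtain ⟨i, hi⟩ : ∃ i, m i ≠ 0 := by
      by_contra! h
      simp [h] at hn
    set m' := Function.update m i (m i - 1) with hm'
    have hmm : Function.update m' i (m' i + 1) = m := by
      rw [hm', Function.update_self, Function.update_idem, Nat.sub_add_cancel (by omega),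
        Function.update_eq_self]
    obtain ⟨x, hx⟩ := ih m' (fun l => by
        by_cases hl : l = i
        · subst hl; rw [hm', Function.update_self]; have := hm l; omega
        · rw [hm', Function.update_of_ne hl]; exact hm l) (by
        rw [hm', Finset.sum_update_of_mem (Finset.mem_univ i)]
        rw [Finset.sum_eq_add_sum_sdiff_singleton_of_mem (Finset.mem_univ i)] at hn
        omega)
    have hs : q ^ (∑ l ∈ Finset.Ioi i, m l) ≠ 0 := pow_ne_zero _ hq
    refine ⟨(q ^ (∑ l ∈ Finset.Ioi i, m l))⁻¹ • (Xgen k c a q i * x), ?_⟩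
    rw [map_smul, map_mul, shiftRep_Xgen, LinearMap.smul_apply, Module.End.mul_apply, hx]
    funext n
    rw [Pi.smul_apply, shiftOp_apply, smul_eq_mul]
    by_cases hnm : n = m
    · subst hnm
      rw [if_pos ⟨by omega, hm i⟩, Pi.single_eq_same, mul_one, inv_mul_cancel₀ hs,
        Pi.single_eq_same]
    · rw [Pi.single_eq_of_ne hnm]
      split_ifs with h
      · rw [Pi.single_eq_of_ne, mul_zero, mul_zero]
        intro h'
        apply hnm
        rw [← hmm, ← h', Function.update_self, Function.update_idem,
          Nat.sub_add_cancel (by omega), Function.update_eq_self]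
      · rw [mul_zero]

lemma pow_le_finrank_QCI (ha : a ≠ 0) (hq : q ≠ 0) [Module.Finite k (QCI k c a q)] :
    a ^ c ≤ Module.finrank k (QCI k c a q) := by
  choose x hx using fun m : Fin c → Fin a =>
    exists_shiftRep_eq_single (k := k) ha hq (fun i => (m i : ℕ)) fun i => (m i).2
  have hli : LinearIndependent k x := by
    refine LinearIndependent.of_comp
      ((LinearMap.applyₗ (Pi.single 0 1)).comp (shiftRep c ha q).toLinearMap) ?_
    have h := (Pi.linearIndependent_single_one (Fin c → ℕ) k).comp
      (fun (m : Fin c → Fin a) i => (m i : ℕ)) (fun m m' h => by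
        funext i
        exact Fin.ext (congrFun h i))
    convert h using 1
    funext m
    exact hx m
  simpa using hli.fintype_card_le_finrank

/-! ### Freeness over `k[u]` -/

lemma adjoin_singleton_le_span {A : Type*} [Ring A] [Algebra k A] {u : A} (hu : u ^ a = 0) :
    Subalgebra.toSubmodule (Algebra.adjoin k {u}) ≤
      Submodule.span k (Set.range fun i : Fin a => u ^ (i : ℕ)) := by
  rw [Algebra.adjoin_eq_span, Submodule.span_le]
  intro x hx
  obtain ⟨n, rfl⟩ := Submonoid.mem_closure_singleton.1 hx
  by_cases hn : n < a
  · exact Submodule.subset_span ⟨⟨n, hn⟩, rfl⟩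
  · rw [pow_eq_zero_of_le (not_lt.1 hn) hu]
    exact zero_mem _

lemma finite_adjoin_singleton {A : Type*} [Ring A] [Algebra k A] {u : A} (hu : u ^ a = 0) :
    Module.Finite k (Algebra.adjoin k {u}) := by
  have := FiniteDimensional.span_of_finite k (Set.finite_range fun i : Fin a => u ^ (i : ℕ))
  exact Submodule.finiteDimensional_of_le (S₁ := Subalgebra.toSubmodule (Algebra.adjoin k {u}))
    (adjoin_singleton_le_span hu)

lemma finrank_adjoin_singleton_le {A : Type*} [Ring A] [Algebra k A] {u : A} (hu : u ^ a = 0) :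
    Module.finrank k (Algebra.adjoin k {u}) ≤ a := by
  have := FiniteDimensional.span_of_finite k (Set.finite_range fun i : Fin a => u ^ (i : ℕ))
  refine (Submodule.finrank_mono (adjoin_singleton_le_span hu)).trans ?_
  simpa [Set.finrank] using finrank_range_le_card (R := k) fun i : Fin a => u ^ (i : ℕ)

lemma bijective_of_surjective_pi_adjoin {A : Type*} [Ring A] [Algebra k A] {u : A}
    (hu : u ^ a = 0) {N : ℕ} (hA : Module.Finite k A → N * a ≤ Module.finrank k A)
    (Φ : (Fin N → Algebra.adjoin k {u}) →ₗ[k] A) (hΦ : Function.Surjective Φ) :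
    Function.Bijective Φ := by
  have := finite_adjoin_singleton (k := k) hu
  have h1 := hA (Module.Finite.of_surjective Φ hΦ)
  have h2 : Module.finrank k (Fin N → Algebra.adjoin k {u}) ≤ N * a := by
    rw [Module.finrank_pi_fintype, Finset.sum_const, Finset.card_univ, Fintype.card_fin,
      smul_eq_mul]
    exact Nat.mul_le_mul_left _ (finrank_adjoin_singleton_le hu)
  have h3 := LinearMap.finrank_le_finrank_of_surjective hΦ
  have := Module.Finite.of_surjective Φ hΦ
  exact ⟨(LinearMap.injective_iff_surjective_of_finrank_eq_finrank
    (le_antisymm (h2.trans h1) h3)).2 hΦ, hΦ⟩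

lemma exists_reduced_qMon {i : Fin c} {l : List (Fin c)} (hmem : ∀ j, j ∈ l ↔ j ≠ i) :
    ∃ v : Fin (a ^ (c - 1)) → QCI k c a q, ∀ e : Fin c → ℕ,
      qMon k c a q l e = 0 ∨ ∃ n, qMon k c a q l e = v n := by
  have hcard : Fintype.card ({j : Fin c // j ≠ i} → Fin a) = Fintype.card (Fin (a ^ (c - 1))) := by
    simp [Fintype.card_subtype_compl]
  let E := Fintype.equivOfCardEq hcard
  refine ⟨fun n => qMon k c a q l fun j => if h : j ≠ i then E.symm n ⟨j, h⟩ else 0, fun e => ?_⟩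
  by_cases h : ∃ j ∈ l, a ≤ e j
  · obtain ⟨j, hj, hje⟩ := h
    exact Or.inl (qMon_eq_zero hj hje)
  · push Not at h
    refine Or.inr ⟨E fun j => ⟨e j, h j ((hmem j).2 j.2)⟩, qMon_congr fun j hj => ?_⟩
    simp [(hmem j).1 hj]

end QCI

/-- for every nonzero `λ ∈ k^c`, the algebra `A` is a free `k[u_λ]`-module of
rank `a^{c-1}`, both as a left `k[u_λ]`-module (scalars acting by multiplication on the
left) and as a right `k[u_λ]`-module (scalars acting by multiplication on the right):
there are families `v, w` of `a^{c-1}` elements of `A` such that every `x ∈ A` is uniquely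
a left (resp. right) `k[u_λ]`-linear combination of the `v i` (resp. `w i`). -/
theorem statement5 (k : Type) [Field k] [IsAlgClosed k] (c a : ℕ) (hc : 2 ≤ c) (ha : 2 ≤ a)
    (b : ℕ) (hb : b = if ringChar k = 0 then a else a / Nat.gcd a (ringChar k))
    (q : k) (hq : IsPrimitiveRoot q b) (lam : Fin c → k) (hlam : lam ≠ 0) :
    (∃ v : Fin (a ^ (c - 1)) → QCI k c a q, ∀ x : QCI k c a q,
      ∃! f : Fin (a ^ (c - 1)) → Algebra.adjoin k {uElt k c a q lam},
        x = ∑ i, (f i : QCI k c a q) * v i) ∧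
    (∃ w : Fin (a ^ (c - 1)) → QCI k c a q, ∀ x : QCI k c a q,
      ∃! g : Fin (a ^ (c - 1)) → Algebra.adjoin k {uElt k c a q lam},
        x = ∑ i, w i * (g i : QCI k c a q)) := by
  have ha0 : a ≠ 0 := by omega
  have hb0 : b ≠ 0 := by
    rw [hb]
    split_ifs
    · exact ha0
    · exact (Nat.div_pos (Nat.gcd_le_left _ (by omega)) (Nat.gcd_pos_of_pos_left _ (by omega))).ne'
  have hq0 : q ≠ 0 := hq.ne_zero hb0
  have hu := uElt_pow (c := c) ha0 hb hq lam
  have hdim : Module.Finite k (QCI k c a q) →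
      a ^ (c - 1) * a ≤ Module.finrank k (QCI k c a q) := fun _ => by
    rw [← pow_succ, Nat.sub_add_cancel (by omega)]
    exact pow_le_finrank_QCI ha0 hq0
  obtain ⟨i, hi⟩ := Function.ne_iff.1 hlam
  have hl : (Finset.univ.erase i).toList.Nodup := Finset.nodup_toList _
  have hmem : ∀ j, j ∈ (Finset.univ.erase i).toList ↔ j ≠ i := by simp
  obtain ⟨v, hv⟩ := exists_reduced_qMon (k := k) (a := a) (q := q) hmem
  refine ⟨⟨v, fun x => ?_⟩, ⟨v, fun x => ?_⟩⟩
  · let Φ : (Fin (a ^ (c - 1)) → Algebra.adjoin k {uElt k c a q lam}) →ₗ[k] QCI k c a q :=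
      { toFun := fun f => ∑ n, (f n : QCI k c a q) * v n
        map_add' := fun f g => by simp [add_mul, Finset.sum_add_distrib]
        map_smul' := fun r f => by simp [Finset.smul_sum] }
    have hΦ : Function.Surjective Φ := by
      rw [← LinearMap.range_eq_top, eq_top_iff, ← span_adjoin_mul_qMon hq0 hi hl hmem,
        Submodule.span_le]
      rintro _ ⟨p, hp, e, rfl⟩
      rcases hv e with h | ⟨n, h⟩
      · rw [h, mul_zero]
        exact zero_mem _
      · refine ⟨Pi.single n ⟨p, hp⟩, ?_⟩
        change ∑ n', ((Pi.single n ⟨p, hp⟩ : Fin (a ^ (c - 1)) → Algebra.adjoin k _) n' : QCI k c a q) *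
          v n' = _
        rw [Finset.sum_eq_single n, h, Pi.single_eq_same]
        · intro n' _ hn'
          rw [Pi.single_eq_of_ne hn', ZeroMemClass.coe_zero, zero_mul]
        · simp
    obtain ⟨f, hf, huniq⟩ := (bijective_of_surjective_pi_adjoin hu hdim Φ hΦ).existsUnique x
    exact ⟨f, hf.symm, fun g hg => huniq g hg.symm⟩
  · let Φ : (Fin (a ^ (c - 1)) → Algebra.adjoin k {uElt k c a q lam}) →ₗ[k] QCI k c a q :=
      { toFun := fun f => ∑ n, v n * (f n : QCI k c a q)
        map_add' := fun f g => by simp [mul_add, Finset.sum_add_distrib]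
        map_smul' := fun r f => by simp [Finset.smul_sum] }
    have hΦ : Function.Surjective Φ := by
      rw [← LinearMap.range_eq_top, eq_top_iff, ← span_qMon_mul_adjoin hq0 hi hl hmem,
        Submodule.span_le]
      rintro _ ⟨p, hp, e, rfl⟩
      rcases hv e with h | ⟨n, h⟩
      · rw [h, zero_mul]
        exact zero_mem _
      · refine ⟨Pi.single n ⟨p, hp⟩, ?_⟩
        change ∑ n', v n' *
          ((Pi.single n ⟨p, hp⟩ : Fin (a ^ (c - 1)) → Algebra.adjoin k _) n' : QCI k c a q) = _
        rw [Finset.sum_eq_single n, h, Pi.single_eq_same]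
        · intro n' _ hn'
          rw [Pi.single_eq_of_ne hn', ZeroMemClass.coe_zero, mul_zero]
        · simp
    obtain ⟨f, hf, huniq⟩ := (bijective_of_surjective_pi_adjoin hu hdim Φ hΦ).existsUnique x
    exact ⟨f, hf.symm, fun g hg => huniq g hg.symm⟩
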